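/- Let G be a compact metric space containing a finite nonempty subset V (the vertex set) such that the set of connected components of G \ V is finite and every such component is homeomorphic to the open interval (0,1); call the closures of these components the edges e₁, …, e_k of G. Let f : G → G be a continuous Markov map, i.e. f(V) ⊆ V and the restriction of f to each edge is injective (then the image of each edge is a union of edges). Define the incidence matrix D = (a_{ij}) ∈ {0,1}^{k×k} by a_{ij} = 1 if e_j ⊆ f(e_i) and a_{ij} = 0 otherwise. Then the topological entropy of f on G equals 0 if D is nilpotent, and equals log λ otherwise, where λ is the spectral radius of D (the maximum modulus of its complex eigenvalues, which by Perron–Frobenius is its greatest nonnegative real eigenvalue). -/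

import Mathlib

open scoped Classical

open Dynamics

set_option linter.unusedSectionVars false

/-- Extracted topological data of a Markov graph map. -/
structure MG {G : Type*} [MetricSpace G] (V : Set G) {k : ℕ} (c : Fin k → Set G)
    (φ : Fin k → ℝ → G) (τ : Fin k → G → ℝ) (f : G → G) : Prop where
  fin : V.Finite
  cover : ∀ x, x ∉ V → ∃ i, x ∈ c i
  isOpen : ∀ i, IsOpen (c i)
  disj : ∀ x i j, x ∈ c i → x ∈ c j → i = j
  cV : ∀ i x, x ∈ c i → x ∉ V
  clos : ∀ i, closure (c i) ⊆ c i ∪ V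
  phi_mem : ∀ i t, t ∈ Set.Ioo (0:ℝ) 1 → φ i t ∈ c i
  tau_mem : ∀ i x, x ∈ c i → τ i x ∈ Set.Ioo (0:ℝ) 1
  phi_tau : ∀ i x, x ∈ c i → φ i (τ i x) = x
  tau_phi : ∀ i t, t ∈ Set.Ioo (0:ℝ) 1 → τ i (φ i t) = t
  phi_cont : ∀ i, ContinuousOn (φ i) (Set.Ioo 0 1)
  tau_cont : ∀ i, ContinuousOn (τ i) (c i)
  cont : Continuous f
  fV : ∀ x ∈ V, f x ∈ V
  inj : ∀ i, Set.InjOn f (closure (c i))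

theorem MG.exists_of {G : Type*} [MetricSpace G]
    (V : Set G) (hVfin : V.Finite)
    (k : ℕ) (c : Fin k → Set G)
    (hc_comp : ∀ i, ∃ x ∈ Vᶜ, c i = connectedComponentIn Vᶜ x)
    (hc_all : ∀ x ∈ Vᶜ, ∃ i, connectedComponentIn Vᶜ x = c i)
    (hc_inj : Function.Injective c)
    (hc_homeo : ∀ i, Nonempty (↥(c i) ≃ₜ ↥(Set.Ioo (0 : ℝ) 1)))
    (f : G → G) (hf : Continuous f)
    (hfV : Set.MapsTo f V V)
    (hMarkov : ∀ i, Set.InjOn f (closure (c i))) :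
    ∃ φ τ, MG V c φ τ f := by
  have hsub : ∀ i, c i ⊆ Vᶜ := by
    intro i
    obtain ⟨x, hx, h⟩ := hc_comp i
    rw [h]; exact connectedComponentIn_subset _ _
  have heq : ∀ i x, x ∈ c i → c i = connectedComponentIn Vᶜ x := by
    intro i x hx
    obtain ⟨y, hy, h⟩ := hc_comp i
    rw [h] at hx ⊢
    exact connectedComponentIn_eq hx
  have hcov : ∀ x, x ∉ V → ∃ i, x ∈ c i := by
    intro x hx
    obtain ⟨i, hi⟩ := hc_all x hx
    exact ⟨i, hi ▸ mem_connectedComponentIn hx⟩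
  have hdisj : ∀ x i j, x ∈ c i → x ∈ c j → i = j := by
    intro x i j hi hj
    exact hc_inj ((heq i x hi).trans (heq j x hj).symm)
  have hpre : ∀ i, IsPreconnected (c i) := by
    intro i
    obtain ⟨x, hx, h⟩ := hc_comp i
    rw [h]; exact isPreconnected_connectedComponentIn
  have hclos : ∀ i, closure (c i) ⊆ c i ∪ V := by
    intro i y hy
    by_cases hyV : y ∈ V
    · exact Or.inr hyV
    left
    have h1 : IsPreconnected (insert y (c i)) :=
      (hpre i).subset_closure (Set.subset_insert _ _)
        (Set.insert_subset hy subset_closure)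
    obtain ⟨x, hx, h⟩ := hc_comp i
    have hxi : x ∈ c i := h ▸ mem_connectedComponentIn hx
    have := h1.subset_connectedComponentIn (F := Vᶜ) (Set.mem_insert_of_mem y hxi)
      (Set.insert_subset hyV (hsub i))
    rw [h]
    exact this (Set.mem_insert _ _)
  have hopen : ∀ i, IsOpen (c i) := by
    intro i
    have : c i = (V ∪ ⋃ j ∈ {j | j ≠ i}, closure (c j))ᶜ := by
      ext x
      simp only [Set.mem_compl_iff, Set.mem_union, Set.mem_iUnion, not_or, not_exists,
        Set.mem_ofPred_eq]
      constructor
      · intro hx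
        refine ⟨hsub i hx, fun j hj hxj => ?_⟩
        rcases hclos j hxj with h | h
        · exact hj (hdisj x j i h hx)
        · exact hsub i hx h
      · rintro ⟨hxV, h⟩
        obtain ⟨j, hj⟩ := hcov x hxV
        by_cases hji : j = i
        · exact hji ▸ hj
        · exact absurd (subset_closure hj) (h j hji)
    rw [this, isOpen_compl_iff]
    exact hVfin.isClosed.union
      ((Set.toFinite _).isClosed_biUnion fun j _ => isClosed_closure)
  have H := fun i => (hc_homeo i).some
  have hex : ∀ i, ∃ φ : ℝ → G, ∀ t (ht : t ∈ Set.Ioo (0:ℝ) 1), φ t = (H i).symm ⟨t, ht⟩ := by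
    intro i
    exact ⟨fun t => if ht : t ∈ Set.Ioo (0:ℝ) 1 then (H i).symm ⟨t, ht⟩ else
      ((H i).symm ⟨1/2, by norm_num, by norm_num⟩ : G), fun t ht => by simp only [dif_pos ht]⟩
  choose φ hφ using hex
  have hex' : ∀ i, ∃ τ : G → ℝ, ∀ t (ht : t ∈ c i), τ t = (H i) ⟨t, ht⟩ := by
    intro i
    exact ⟨fun t => if ht : t ∈ c i then (H i) ⟨t, ht⟩ else 0,
      fun t ht => by simp only [dif_pos ht]⟩
  choose τ hτ using hex'
  refine ⟨φ, τ, hVfin, hcov, hopen, hdisj, fun i x hx => hsub i hx, hclos, ?_, ?_, ?_, ?_, ?_, ?_,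
    hf, fun x hx => hfV hx, hMarkov⟩
  · intro i t ht
    rw [hφ i t ht]; exact Subtype.coe_prop _
  · intro i x hx
    rw [hτ i x hx]; exact Subtype.coe_prop _
  · intro i x hx
    have := Subtype.coe_prop ((H i) ⟨x, hx⟩)
    rw [hτ i x hx, hφ i _ this]
    simp
  · intro i t ht
    have := Subtype.coe_prop ((H i).symm ⟨t, ht⟩)
    rw [hφ i t ht, hτ i _ this]
    simp
  · intro i
    rw [continuousOn_iff_continuous_domRestrict]
    convert! continuous_subtype_val.comp (H i).symm.continuous using 1
    ext t
    exact hφ i t t.2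
  · intro i
    rw [continuousOn_iff_continuous_domRestrict]
    convert! continuous_subtype_val.comp (H i).continuous using 1
    ext t
    exact hτ i t t.2


theorem strictMono_or_anti_of_ordConnected {I : Set ℝ} (hI : I.OrdConnected) {g : ℝ → ℝ}
    (hc : ContinuousOn g I) (hi : Set.InjOn g I) : StrictMonoOn g I ∨ StrictAntiOn g I := by
  rcases I.eq_empty_or_nonempty with rfl | hne
  · left; intro x hx; exact hx.elim
  have : Inhabited I := Classical.inhabited_of_nonempty hne.to_subtype
  let g' : I → ℝ := Set.domRestrict I g
  have : StrictMono g' ∨ StrictAnti g' :=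
    Continuous.strictMono_of_inj hc.domRestrict hi.injective
  rcases this with hm | hm
  · left; intro x hx y hy hxy; exact hm (a := ⟨x, hx⟩) (b := ⟨y, hy⟩) hxy
  · right; intro x hx y hy hxy; exact hm (a := ⟨x, hx⟩) (b := ⟨y, hy⟩) hxy

namespace MG

variable {G : Type*} [MetricSpace G] {V : Set G} {k : ℕ} {c : Fin k → Set G}
    {φ : Fin k → ℝ → G} {τ : Fin k → G → ℝ} {f : G → G}

theorem tau_inj (h : MG V c φ τ f) (i : Fin k) : Set.InjOn (τ i) (c i) := by
  intro x hx y hy hxy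
  rw [← h.phi_tau i x hx, ← h.phi_tau i y hy, hxy]

theorem phi_image (h : MG V c φ τ f) (i : Fin k) : φ i '' Set.Ioo 0 1 = c i := by
  ext x
  constructor
  · rintro ⟨t, ht, rfl⟩; exact h.phi_mem i t ht
  · intro hx; exact ⟨_, h.tau_mem i x hx, h.phi_tau i x hx⟩

theorem preconn (h : MG V c φ τ f) (i : Fin k) : IsPreconnected (c i) := by
  rw [← h.phi_image i]
  exact isPreconnected_Ioo.image _ (h.phi_cont i)

theorem isOpen_pre (h : MG V c φ τ f) (i : Fin k) {O : Set G} (hO : IsOpen O) :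
    IsOpen (Set.Ioo 0 1 ∩ φ i ⁻¹' O) :=
  (h.phi_cont i).isOpen_inter_preimage isOpen_Ioo hO

theorem isOpen_tau (h : MG V c φ τ f) (i : Fin k) {O : Set G} (hO : IsOpen O) (hOc : O ⊆ c i) :
    IsOpen (τ i '' O) := by
  convert! h.isOpen_pre i hO using 1
  ext t
  constructor
  · rintro ⟨x, hx, rfl⟩
    exact ⟨h.tau_mem i x (hOc hx), by simpa [h.phi_tau i x (hOc hx)] using hx⟩
  · rintro ⟨ht, hx⟩
    exact ⟨_, hx, h.tau_phi i t ht⟩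

theorem closure_image (h : MG V c φ τ f) {i j : Fin k} {x : G} (hx : x ∈ closure (c i))
    (hy : f x ∈ c j) : x ∈ c i := by
  rcases h.clos i hx with h1 | h1
  · exact h1
  · exact absurd (h.fV x h1) (h.cV j _ hy)

theorem image_isOpen (h : MG V c φ τ f) (i j : Fin k) : IsOpen (c j ∩ f '' c i) := by
  rw [isOpen_iff_mem_nhds]
  rintro _ ⟨hj, x, hx, rfl⟩
  have hO : IsOpen (c i ∩ f ⁻¹' c j) := (h.isOpen i).inter ((h.isOpen j).preimage h.cont)
  have hP := h.isOpen_pre i hO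
  have ht : τ i x ∈ Set.Ioo 0 1 ∩ φ i ⁻¹' (c i ∩ f ⁻¹' c j) := by
    refine ⟨h.tau_mem i x hx, ?_⟩
    simp only [Set.mem_preimage, h.phi_tau i x hx]
    exact ⟨hx, hj⟩
  obtain ⟨ε, hε, hball⟩ := Metric.isOpen_iff.1 hP _ ht
  set t := τ i x with ht_def
  have hsub : Set.Icc (t - ε/2) (t + ε/2) ⊆ Set.Ioo 0 1 ∩ φ i ⁻¹' (c i ∩ f ⁻¹' c j) := by
    intro s hs
    apply hball
    rw [Metric.mem_ball, Real.dist_eq, abs_lt]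
    constructor <;> linarith [hs.1, hs.2]
  set ψ : ℝ → ℝ := fun s => τ j (f (φ i s)) with hψ
  have hψc : ContinuousOn ψ (Set.Icc (t - ε/2) (t + ε/2)) := by
    refine (h.tau_cont j).comp (h.cont.comp_continuousOn ((h.phi_cont i).mono ?_)) ?_
    · exact fun s hs => (hsub hs).1
    · exact fun s hs => (hsub hs).2.2
  have hψi : Set.InjOn ψ (Set.Icc (t - ε/2) (t + ε/2)) := by
    intro s hs s' hs' hss
    have h1 := h.tau_inj j (hsub hs).2.2 (hsub hs').2.2 hss
    have h2 := h.inj i (subset_closure (hsub hs).2.1) (subset_closure (hsub hs').2.1) h1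
    rw [← h.tau_phi i s (hsub hs).1, ← h.tau_phi i s' (hsub hs').1, h2]
  have hψt : ψ t = τ j (f x) := by simp [hψ, ht_def, h.phi_tau i x hx]
  have key : ψ '' Set.Icc (t - ε/2) (t + ε/2) ∈ nhds (τ j (f x)) := by
    have hm1 : t - ε/2 ∈ Set.Icc (t - ε/2) (t + ε/2) := ⟨le_rfl, by linarith⟩
    have hm2 : t ∈ Set.Icc (t - ε/2) (t + ε/2) := ⟨by linarith, by linarith⟩
    have hm3 : t + ε/2 ∈ Set.Icc (t - ε/2) (t + ε/2) := ⟨by linarith, le_rfl⟩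
    rcases hψc.strictMonoOn_of_injOn_Icc' (by linarith) hψi with hm | hm
    · refine Filter.mem_of_superset ?_ (intermediate_value_Icc (by linarith) hψc)
      rw [← hψt]
      exact Icc_mem_nhds (hm hm1 hm2 (by linarith)) (hm hm2 hm3 (by linarith))
    · refine Filter.mem_of_superset ?_ (intermediate_value_Icc' (by linarith) hψc)
      rw [← hψt]
      exact Icc_mem_nhds (hm hm2 hm3 (by linarith)) (hm hm1 hm2 (by linarith))
  have h3 := ((h.tau_cont j).continuousAt ((h.isOpen j).mem_nhds hj)).preimage_mem_nhds key
  filter_upwards [h3, (h.isOpen j).mem_nhds hj] with y hy hyj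
  refine ⟨hyj, ?_⟩
  obtain ⟨s, hs, hsy⟩ := hy
  exact ⟨φ i s, (hsub hs).2.1, h.tau_inj j (hsub hs).2.2 hyj hsy⟩

variable [CompactSpace G]

theorem full (h : MG V c φ τ f) {i j : Fin k} {x : G} (hx : x ∈ c i) (hy : f x ∈ c j) :
    c j ⊆ f '' c i := by
  have h1 := h.image_isOpen i j
  have hcl : IsClosed (f '' closure (c i)) :=
    (isClosed_closure.isCompact.image h.cont).isClosed
  have h2 : c j ⊆ c j ∩ f '' c i := by
    refine (h.preconn j).subset_left_of_subset_union h1 hcl.isOpen_compl ?_ ?_ ?_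
    · rw [Set.disjoint_left]
      rintro y ⟨_, hy⟩ hy'
      exact hy' (Set.image_mono subset_closure hy)
    · intro y hy
      by_cases hy' : y ∈ f '' closure (c i)
      · left
        obtain ⟨z, hz, rfl⟩ := hy'
        exact ⟨hy, z, h.closure_image hz hy, rfl⟩
      · exact Or.inr hy'
    · exact ⟨f x, hy, hy, x, hx, rfl⟩
  exact fun y hy => (h2 hy).2

theorem edge_iff (h : MG V c φ τ f) (i j : Fin k) :
    closure (c j) ⊆ f '' closure (c i) ↔ ∃ x ∈ c i, f x ∈ c j := by
  constructor
  · intro hs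
    have h1 : (1/2 : ℝ) ∈ Set.Ioo (0:ℝ) 1 := by constructor <;> norm_num
    have h2 := h.phi_mem j _ h1
    obtain ⟨x, hx, hxy⟩ := hs (subset_closure h2)
    rw [← hxy] at h2
    exact ⟨x, h.closure_image hx h2, h2⟩
  · rintro ⟨x, hx, hy⟩
    have hcl : IsClosed (f '' closure (c i)) :=
      (isClosed_closure.isCompact.image h.cont).isClosed
    exact hcl.closure_subset_iff.2 ((h.full hx hy).trans (Set.image_mono subset_closure))

theorem preconn_pre (h : MG V c φ τ f) {i j : Fin k} (hij : ∃ x ∈ c i, f x ∈ c j) {S : Set G}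
    (hS : S ⊆ c j) (hSp : IsPreconnected S) : IsPreconnected (c i ∩ f ⁻¹' S) := by
  obtain ⟨x, hx, hy⟩ := hij
  have hfull := h.full hx hy
  -- inverse of f on the closure
  have : CompactSpace (closure (c i)) :=
    isCompact_iff_compactSpace.1 isClosed_closure.isCompact
  let g : closure (c i) → G := fun z => f z
  have hg : Topology.IsClosedEmbedding g :=
    Continuous.isClosedEmbedding (h.cont.comp continuous_subtype_val)
      (fun a b hab => Subtype.ext (h.inj i a.2 b.2 hab))
  have h1 : IsPreconnected (g ⁻¹' S) := by
    rw [← hg.isInducing.isPreconnected_image, Set.image_preimage_eq_of_subset]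
    · exact hSp
    · intro y hy
      obtain ⟨z, hz, rfl⟩ := hfull (hS hy)
      exact ⟨⟨z, subset_closure hz⟩, rfl⟩
  convert! h1.image Subtype.val continuous_subtype_val.continuousOn using 1
  ext z
  constructor
  · rintro ⟨hz, hzS⟩
    exact ⟨⟨z, subset_closure hz⟩, hzS, rfl⟩
  · rintro ⟨w, hw, rfl⟩
    exact ⟨h.closure_image w.2 (hS hw), hw⟩

end MG

/-- cylinder sets -/
def cyl {G : Type*} {k : ℕ} (c : Fin k → Set G) (f : G → G) : List (Fin k) → Set G
  | [] => Set.univ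
  | i :: w => c i ∩ f ⁻¹' cyl c f w

/-- admissible words of length `n` following `i` -/
noncomputable def wds {G : Type*} {k : ℕ} (c : Fin k → Set G) (f : G → G) (n : ℕ) (i : Fin k) :
    Finset (List (Fin k)) :=
  (List.finite_length_eq (Fin k) n).toFinset.filter fun w => (cyl c f (i :: w)).Nonempty

/-- admissible words of length `n` -/
noncomputable def awds {G : Type*} {k : ℕ} (c : Fin k → Set G) (f : G → G) (n : ℕ) :
    Finset (List (Fin k)) :=
  (List.finite_length_eq (Fin k) n).toFinset.filter fun w => (cyl c f w).Nonempty

theorem mem_wds {G : Type*} {k : ℕ} {c : Fin k → Set G} {f : G → G} {n : ℕ} {i : Fin k}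
    {w : List (Fin k)} : w ∈ wds c f n i ↔ w.length = n ∧ (cyl c f (i :: w)).Nonempty := by
  simp [wds]

theorem mem_awds {G : Type*} {k : ℕ} {c : Fin k → Set G} {f : G → G} {n : ℕ}
    {w : List (Fin k)} : w ∈ awds c f n ↔ w.length = n ∧ (cyl c f w).Nonempty := by
  simp [awds]

theorem mem_cyl_append {G : Type*} {k : ℕ} {c : Fin k → Set G} {f : G → G}
    (u v : List (Fin k)) (x : G) :
    x ∈ cyl c f (u ++ v) ↔ x ∈ cyl c f u ∧ f^[u.length] x ∈ cyl c f v := by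
  induction u generalizing x with
  | nil => simp [cyl]
  | cons i u ih =>
    simp only [List.cons_append, cyl, Set.mem_inter_iff, Set.mem_preimage, ih, List.length_cons,
      Function.iterate_succ_apply, and_assoc]

theorem mem_cyl_get {G : Type*} {k : ℕ} {c : Fin k → Set G} {f : G → G}
    (u : List (Fin k)) (x : G) (hx : x ∈ cyl c f u) (m : ℕ) (hm : m < u.length) :
    f^[m] x ∈ c u[m] := by
  induction u generalizing x m with
  | nil => simp at hm
  | cons i u ih =>
    cases m with
    | zero => exact hx.1
    | succ m => exact ih (f x) hx.2 m (by simpa using hm)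

namespace MG

variable {G : Type*} [MetricSpace G] {V : Set G} {k : ℕ} {c : Fin k → Set G}
    {φ : Fin k → ℝ → G} {τ : Fin k → G → ℝ} {f : G → G}

theorem cyl_open (h : MG V c φ τ f) (w : List (Fin k)) : IsOpen (cyl c f w) := by
  induction w with
  | nil => exact isOpen_univ
  | cons i w ih => exact (h.isOpen i).inter (ih.preimage h.cont)

theorem cyl_disj (h : MG V c φ τ f) (w w' : List (Fin k)) (hl : w.length = w'.length) (x : G)
    (hx : x ∈ cyl c f w) (hx' : x ∈ cyl c f w') : w = w' := by
  induction w generalizing w' x with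
  | nil => cases w' with
    | nil => rfl
    | cons => simp at hl
  | cons i w ih => cases w' with
    | nil => simp at hl
    | cons j w' =>
      rw [h.disj x i j hx.1 hx'.1, ih w' (by simpa using hl) (f x) hx.2 hx'.2]

theorem cyl_inj (h : MG V c φ τ f) (w : List (Fin k)) (m : ℕ) (hm : m ≤ w.length) :
    Set.InjOn (f^[m]) (cyl c f w) := by
  induction w generalizing m with
  | nil => simp at hm; subst hm; exact fun x _ y _ hxy => hxy
  | cons i w ih =>
    cases m with
    | zero => exact fun x _ y _ hxy => hxy
    | succ m =>
      intro x hx y hy hxy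
      exact h.inj i (subset_closure hx.1) (subset_closure hy.1)
        (ih m (by simpa using hm) hx.2 hy.2 hxy)

theorem exists_word (h : MG V c φ τ f) (n : ℕ) (x : G) (hx : ∀ m < n, f^[m] x ∉ V) :
    ∃ w : List (Fin k), w.length = n ∧ x ∈ cyl c f w := by
  induction n generalizing x with
  | zero => exact ⟨[], rfl, trivial⟩
  | succ n ih =>
    obtain ⟨i, hi⟩ := h.cover x (hx 0 (by omega))
    obtain ⟨w, hw, hxw⟩ := ih (f x) (fun m hm => hx (m+1) (by omega))
    exact ⟨i :: w, by simp [hw], hi, hxw⟩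

variable [CompactSpace G]

theorem cyl_preconn (h : MG V c φ τ f) (i : Fin k) (w : List (Fin k))
    (hne : (cyl c f (i :: w)).Nonempty) : IsPreconnected (cyl c f (i :: w)) := by
  induction w generalizing i with
  | nil => simpa [cyl] using h.preconn i
  | cons j w ih =>
    obtain ⟨x, hx⟩ := hne
    exact h.preconn_pre ⟨x, hx.1, hx.2.1⟩ (Set.inter_subset_left) (ih j ⟨f x, hx.2⟩)

theorem cyl_nonempty_iff (h : MG V c φ τ f) (i j : Fin k) (w : List (Fin k)) :
    (cyl c f (i :: j :: w)).Nonempty ↔ (∃ x ∈ c i, f x ∈ c j) ∧ (cyl c f (j :: w)).Nonempty := by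
  constructor
  · rintro ⟨x, hx⟩
    exact ⟨⟨x, hx.1, hx.2.1⟩, ⟨f x, hx.2⟩⟩
  · rintro ⟨⟨x, hx, hy⟩, ⟨y, hyw⟩⟩
    obtain ⟨z, hz, rfl⟩ := h.full hx hy hyw.1
    exact ⟨z, hz, hyw⟩

theorem card_wds_zero (h : MG V c φ τ f) (i : Fin k) : (wds c f 0 i).card = 1 := by
  rw [Finset.card_eq_one]
  refine ⟨[], ?_⟩
  ext w
  simp only [mem_wds, List.length_eq_zero_iff, Finset.mem_singleton]
  constructor
  · exact fun h => h.1
  · rintro rfl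
    exact ⟨rfl, φ i (1/2), h.phi_mem i _ (by constructor <;> norm_num), trivial⟩

theorem card_wds_succ (h : MG V c φ τ f) (n : ℕ) (i : Fin k) : (wds c f (n+1) i).card =
    ∑ j, (if ∃ x ∈ c i, f x ∈ c j then 1 else 0) * (wds c f n j).card := by
  have : wds c f (n+1) i = (Finset.univ.filter fun j => ∃ x ∈ c i, f x ∈ c j).biUnion
      fun j => (wds c f n j).image (List.cons j) := by
    ext w
    simp only [mem_wds, Finset.mem_biUnion, Finset.mem_filter, Finset.mem_univ, true_and,
      Finset.mem_image]
    cases w with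
    | nil => simp
    | cons j w =>
      rw [h.cyl_nonempty_iff]
      constructor
      · rintro ⟨hl, he, hw⟩
        exact ⟨j, he, w, ⟨by simpa using hl, hw⟩, rfl⟩
      · rintro ⟨j', he, w', ⟨hl, hw⟩, heq⟩
        obtain ⟨rfl, rfl⟩ := List.cons.inj heq
        exact ⟨by simp [hl], he, hw⟩
  rw [this, Finset.card_biUnion]
  · rw [Finset.sum_filter]
    refine Finset.sum_congr rfl fun j _ => ?_
    rw [Finset.card_image_of_injective _ (List.cons_injective)]
    split_ifs <;> simp
  · intro a _ b _ hab
    simp only [Function.onFun]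
    rw [Finset.disjoint_left]
    intro w hw hw'
    simp only [Finset.mem_image] at hw hw'
    obtain ⟨u, _, rfl⟩ := hw
    obtain ⟨u', _, h'⟩ := hw'
    exact hab (List.cons.inj h').1.symm

theorem card_awds_succ (n : ℕ) : (awds c f (n+1)).card = ∑ i, (wds c f n i).card := by
  have : awds c f (n+1) = Finset.univ.biUnion fun j => (wds c f n j).image (List.cons j) := by
    ext w
    simp only [mem_wds, mem_awds, Finset.mem_biUnion, Finset.mem_univ, true_and,
      Finset.mem_image]
    cases w with
    | nil => simp
    | cons j w =>
      constructor
      · rintro ⟨hl, hw⟩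
        exact ⟨j, w, ⟨by simpa using hl, hw⟩, rfl⟩
      · rintro ⟨j', w', ⟨hl, hw⟩, heq⟩
        obtain ⟨rfl, rfl⟩ := List.cons.inj heq
        exact ⟨by simp [hl], hw⟩
  rw [this, Finset.card_biUnion]
  · refine Finset.sum_congr rfl fun j _ => ?_
    rw [Finset.card_image_of_injective _ (List.cons_injective)]
  · intro a _ b _ hab
    simp only [Function.onFun]
    rw [Finset.disjoint_left]
    intro w hw hw'
    simp only [Finset.mem_image] at hw hw'
    obtain ⟨u, _, rfl⟩ := hw
    obtain ⟨u', _, h'⟩ := hw'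
    exact hab (List.cons.inj h').1.symm

end MG

theorem germ_of_closure {I : Set ℝ} (hI : I.OrdConnected) (ho : IsOpen I) (hne : I.Nonempty)
    {t : ℝ} (ht : t ∈ closure I) : I ∈ nhdsWithin t (Set.Iio t) ∨ I ∈ nhdsWithin t (Set.Ioi t) := by
  by_cases htI : t ∈ I
  · left; exact mem_nhdsWithin_of_mem_nhds (ho.mem_nhds htI)
  obtain ⟨s, hs⟩ := hne
  rcases lt_trichotomy s t with hst | hst | hst
  · left
    refine Filter.mem_of_superset (Ioo_mem_nhdsLT hst) ?_
    intro z hz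
    obtain ⟨u, hu, huI⟩ := mem_closure_iff_nhds.1 ht (Set.Ioi z) (Ioi_mem_nhds hz.2)
    exact hI.out hs huI ⟨hz.1.le, le_of_lt hu⟩
  · exact absurd (hst ▸ hs) htI
  · right
    refine Filter.mem_of_superset (Ioo_mem_nhdsGT hst) ?_
    intro z hz
    obtain ⟨u, hu, huI⟩ := mem_closure_iff_nhds.1 ht (Set.Iio z) (Iio_mem_nhds hz.1)
    exact hI.out huI hs ⟨le_of_lt hu, hz.2.le⟩

/-- base points of germs -/
def germPt (t : ℝ) : Fin 3 → ℝ
  | 0 => 0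
  | 1 => 1
  | 2 => t

/-- germ filters -/
def germF (t : ℝ) : Bool → Filter ℝ
  | true => nhdsWithin t (Set.Iio t)
  | false => nhdsWithin t (Set.Ioi t)

instance germF_neBot (t : ℝ) (b : Bool) : (germF t b).NeBot := by
  cases b
  · exact nhdsGT_neBot t
  · exact nhdsLT_neBot t

namespace MG

variable {G : Type*} [MetricSpace G] {V : Set G} {k : ℕ} {c : Fin k → Set G}
    {φ : Fin k → ℝ → G} {τ : Fin k → G → ℝ} {f : G → G} [CompactSpace G]

theorem tau_cyl (h : MG V c φ τ f) (i : Fin k) (w : List (Fin k))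
    (hne : (cyl c f (i :: w)).Nonempty) : (τ i '' cyl c f (i :: w)).OrdConnected :=
  ((h.cyl_preconn i w hne).image _ ((h.tau_cont i).mono Set.inter_subset_left)).ordConnected

theorem germ_exists (h : MG V c φ τ f) (y : G) (i : Fin k) (w : List (Fin k))
    (hne : (cyl c f (i :: w)).Nonempty) (hy : y ∈ closure (cyl c f (i :: w))) :
    ∃ (a : Fin 3) (b : Bool), τ i '' cyl c f (i :: w) ∈ germF (germPt (τ i y) a) b := by
  have hsub : cyl c f (i :: w) ⊆ c i := Set.inter_subset_left
  have h1 := h.tau_cyl i w hne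
  have h2 := h.isOpen_tau i (h.cyl_open (i :: w)) hsub
  have h3 : (τ i '' cyl c f (i :: w)).Nonempty := hne.image _
  suffices ∃ a : Fin 3, germPt (τ i y) a ∈ closure (τ i '' cyl c f (i :: w)) by
    obtain ⟨a, ha⟩ := this
    rcases germ_of_closure h1 h2 h3 ha with h' | h'
    · exact ⟨a, true, h'⟩
    · exact ⟨a, false, h'⟩
  by_cases hyc : y ∈ c i
  · refine ⟨2, ?_⟩
    have := (h.tau_cont i).continuousAt ((h.isOpen i).mem_nhds hyc)
    exact mem_closure_image this hy
  · by_contra hcon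
    push Not at hcon
    have hI01 : τ i '' cyl c f (i :: w) ⊆ Set.Ioo 0 1 := by
      rintro _ ⟨x, hx, rfl⟩; exact h.tau_mem i x (hsub hx)
    have hcl : closure (τ i '' cyl c f (i :: w)) ⊆ Set.Ioo 0 1 := by
      intro t ht
      have h4 : t ∈ Set.Icc (0:ℝ) 1 :=
        closure_minimal (hI01.trans Set.Ioo_subset_Icc_self) isClosed_Icc ht
      refine ⟨lt_of_le_of_ne h4.1 ?_, lt_of_le_of_ne h4.2 ?_⟩
      · rintro rfl; exact hcon 0 ht
      · rintro rfl; exact hcon 1 ht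
    have hcomp : IsCompact (closure (τ i '' cyl c f (i :: w))) :=
      isCompact_Icc.of_isClosed_subset isClosed_closure
        (hcl.trans Set.Ioo_subset_Icc_self)
    have hcomp2 := (hcomp.image_of_continuousOn ((h.phi_cont i).mono hcl)).isClosed
    have h5 : cyl c f (i :: w) ⊆ φ i '' closure (τ i '' cyl c f (i :: w)) := by
      intro x hx
      exact ⟨τ i x, subset_closure ⟨x, hx, rfl⟩, h.phi_tau i x (hsub hx)⟩
    obtain ⟨t, ht, rfl⟩ := closure_minimal h5 hcomp2 hy
    exact hyc (h.phi_mem i t (hcl ht))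

theorem germ_card (h : MG V c φ τ f) (y : G) (m : ℕ) :
    ((awds c f (m+1)).filter fun w => y ∈ closure (cyl c f w)).card ≤ 6 * k := by
  have hex : ∀ w ∈ (awds c f (m+1)).filter fun w => y ∈ closure (cyl c f w),
      ∃ p : Fin k × Fin 3 × Bool, ∃ u, w = p.1 :: u ∧
        τ p.1 '' cyl c f w ∈ germF (germPt (τ p.1 y) p.2.1) p.2.2 := by
    intro w hw
    rw [Finset.mem_filter, mem_awds] at hw
    obtain ⟨⟨hl, hne⟩, hy⟩ := hw
    cases w with
    | nil => simp at hl
    | cons i u =>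
      obtain ⟨a, b, hab⟩ := h.germ_exists y i u hne hy
      exact ⟨(i, a, b), u, rfl, hab⟩
  rcases isEmpty_or_nonempty (Fin k) with he | he
  · rw [Finset.card_eq_zero.2 (Finset.eq_empty_of_forall_notMem fun w hw =>
      he.elim (hex w hw).choose.1)]
    exact Nat.zero_le _
  choose! p hp using hex
  have hcard : Fintype.card (Fin k × Fin 3 × Bool) = 6 * k := by
    simp; ring
  rw [← hcard, ← Finset.card_univ]
  refine Finset.card_le_card_of_injOn p (fun _ _ => Finset.mem_coe.2 (Finset.mem_univ _)) ?_
  intro w hw w' hw' heq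
  obtain ⟨u, hu, hg⟩ := hp w hw
  obtain ⟨u', hu', hg'⟩ := hp w' hw'
  rw [← heq] at hg' hu'
  obtain ⟨t, ⟨x, hx, hxt⟩, ⟨x', hx', hxt'⟩⟩ := Filter.nonempty_of_mem (Filter.inter_mem hg hg')
  have hxc : x ∈ c (p w).1 := by rw [hu] at hx; exact hx.1
  have hxc' : x' ∈ c (p w).1 := by rw [hu'] at hx'; exact hx'.1
  have : x = x' := h.tau_inj _ hxc hxc' (hxt.trans hxt'.symm)
  subst this
  rw [Finset.mem_coe, Finset.mem_filter, mem_awds] at hw hw'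
  exact h.cyl_disj w w' (hw.1.1.trans hw'.1.1.symm) x hx hx'

theorem exists_entourage (h : MG V c φ τ f) (m : ℕ) : ∃ U ∈ uniformity G, ∀ y : G,
    ((awds c f (m+1)).filter fun w => ∃ x ∈ cyl c f w, (x, y) ∈ U).card ≤ 6 * k := by
  obtain ⟨W, hW, hWb⟩ := lebesgue_number_lemma_nhds (α := G) (K := Set.univ) isCompact_univ
    (U := fun y => (⋃ w ∈ (awds c f (m+1)).filter (fun w => y ∉ closure (cyl c f w)),
      closure (cyl c f w))ᶜ) (by
      intro y _
      refine IsOpen.mem_nhds ?_ ?_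
      · rw [isOpen_compl_iff]
        exact isClosed_biUnion_finset fun w _ => isClosed_closure
      · simp only [Set.mem_compl_iff, Set.mem_iUnion, Finset.mem_filter, not_exists]
        rintro w ⟨_, hw⟩ hw'
        exact hw hw')
  refine ⟨Prod.swap ⁻¹' W, tendsto_swap_uniformity hW, fun y => ?_⟩
  obtain ⟨z, hz⟩ := hWb y trivial
  refine le_trans (Finset.card_le_card ?_) (h.germ_card z m)
  intro w hw
  rw [Finset.mem_filter] at hw ⊢
  refine ⟨hw.1, ?_⟩
  obtain ⟨x, hx, hxy⟩ := hw.2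
  by_contra hcon
  have := hz (show x ∈ UniformSpace.ball y W from hxy)
  apply this
  simp only [Set.mem_iUnion, Finset.mem_filter]
  exact ⟨w, ⟨hw.1, hcon⟩, subset_closure hx⟩

theorem count_block (h : MG V c φ τ f) (m : ℕ) (U : Set (G × G)) (hU : ∀ y : G,
    ((awds c f (m+1)).filter fun w => ∃ x ∈ cyl c f w, (x, y) ∈ U).card ≤ 6 * k) (n : ℕ) (y : G) :
    ((awds c f (n*m+1)).filter fun w => ∃ x ∈ cyl c f w,
      ∀ j < n, (f^[j*m] x, f^[j*m] y) ∈ U).card ≤ k * (6 * k)^n := by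
  induction n generalizing y with
  | zero =>
    refine (Finset.card_filter_le _ _).trans ?_
    rw [zero_mul, card_awds_succ]
    simp [h.card_wds_zero]
  | succ n ih =>
    have h1 := Nat.mul_le_mul (hU y) (ih (f^[m] y))
    rw [← Finset.card_product] at h1
    refine le_trans ?_ (h1.trans (le_of_eq (by ring)))
    refine Finset.card_le_card_of_injOn (fun w => (w.take (m+1), w.drop m)) ?_ ?_
    · intro w hw
      rw [Finset.mem_coe, Finset.mem_filter, mem_awds] at hw
      obtain ⟨⟨hl, _⟩, x, hx, hxU⟩ := hw
      rw [Finset.mem_coe, Finset.mem_product, Finset.mem_filter, Finset.mem_filter, mem_awds,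
        mem_awds]
      have hx1 : x ∈ cyl c f (w.take (m+1)) := by
        rw [← List.take_append_drop (m+1) w, mem_cyl_append] at hx
        exact hx.1
      have hlm : (w.take m).length = m := by
        rw [List.length_take, hl]; apply min_eq_left; nlinarith
      have hx2 : f^[m] x ∈ cyl c f (w.drop m) := by
        rw [← List.take_append_drop m w, mem_cyl_append, hlm] at hx
        exact hx.2
      refine ⟨⟨⟨?_, x, hx1⟩, x, hx1, by simpa using hxU 0 (by omega)⟩,
        ⟨?_, _, hx2⟩, _, hx2, ?_⟩
      · rw [List.length_take, hl]; apply min_eq_left; nlinarith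
      · rw [List.length_drop, hl, Nat.sub_eq_iff_eq_add (by nlinarith)]; ring
      · intro j hj
        have := hxU (j+1) (by omega)
        rw [← Function.iterate_add_apply, ← Function.iterate_add_apply]
        rwa [add_mul, one_mul] at this
    · intro w _ w' _ heq
      simp only [Prod.mk.injEq] at heq
      rw [← List.take_append_drop m w, ← List.take_append_drop m w', heq.2]
      congr 1
      have := congrArg (List.take m) heq.1
      simpa [List.take_take] using this

theorem lower (h : MG V c φ τ f) (m : ℕ) : ∃ U ∈ uniformity G, ∀ (n : ℕ) (s : Finset G),
    IsDynCoverOf f Set.univ U (n*m+1) (s : Set G) →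
      (awds c f (n*m+1)).card ≤ s.card * (k * (6 * k)^n) := by
  obtain ⟨U, hU, hUc⟩ := h.exists_entourage m
  refine ⟨U, hU, fun n s hs => ?_⟩
  have : awds c f (n*m+1) ⊆ s.biUnion fun y => (awds c f (n*m+1)).filter fun w => ∃ x ∈ cyl c f w,
      ∀ j < n, (f^[j*m] x, f^[j*m] y) ∈ U := by
    intro w hw
    obtain ⟨x, hx⟩ := (mem_awds.1 hw).2
    obtain ⟨y, hy, hxy⟩ := hs (Set.mem_univ x)
    rw [Finset.mem_biUnion]
    refine ⟨y, hy, ?_⟩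
    rw [Finset.mem_filter]
    refine ⟨hw, x, hx, fun j hj => ?_⟩
    exact mem_dynEntourage.1 hxy (j*m) (by nlinarith)
  refine (Finset.card_le_card this).trans ?_
  refine Finset.card_biUnion_le_card_mul _ _ _ fun y _ => ?_
  exact h.count_block m U hUc n y

end MG

namespace MG

variable {G : Type*} [MetricSpace G] {V : Set G} {k : ℕ} {c : Fin k → Set G}
    {φ : Fin k → ℝ → G} {τ : Fin k → G → ℝ} {f : G → G} [CompactSpace G]

theorem near_end (h : MG V c φ τ f) (i : Fin k) {ε : ℝ} (hε : 0 < ε) :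
    ∃ δ > 0, ∀ a b : ℝ, Set.Ioo a b ⊆ Set.Ioo 0 1 → (b ≤ δ ∨ 1 - δ ≤ a) →
      ∀ t ∈ Set.Ioo a b, ∀ t' ∈ Set.Ioo a b, dist (φ i t) (φ i t') < ε := by
  obtain ⟨U, hU, hUd⟩ := h.fin.t2_separation
  let O : G → Set G := fun v => U v ∩ Metric.ball v (ε/2)
  have hO : ∀ v, IsOpen (O v) := fun v => (hU v).2.inter Metric.isOpen_ball
  have hOm : ∀ v, v ∈ O v := fun v => ⟨(hU v).1, Metric.mem_ball_self (by linarith)⟩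
  let K : Set G := closure (c i) \ ⋃ v ∈ V, O v
  have hK : IsCompact K :=
    (isClosed_closure.isCompact).diff (isOpen_biUnion fun v _ => hO v)
  have hKc : K ⊆ c i := by
    intro x hx
    rcases h.clos i hx.1 with h1 | h1
    · exact h1
    · exact absurd (Set.mem_biUnion h1 (hOm x)) hx.2
  have hT : IsCompact (τ i '' K) := hK.image_of_continuousOn ((h.tau_cont i).mono hKc)
  have hTs : τ i '' K ⊆ Set.Ioo 0 1 := by
    rintro _ ⟨x, hx, rfl⟩; exact h.tau_mem i x (hKc hx)
  obtain ⟨δ, hδ, hth⟩ := hT.exists_thickening_subset_open isOpen_Ioo hTs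
  refine ⟨δ/2, by linarith, ?_⟩
  intro a b hab hend t ht t' ht'
  have hP : IsPreconnected (φ i '' Set.Ioo a b) :=
    isPreconnected_Ioo.image _ ((h.phi_cont i).mono hab)
  have hPs : φ i '' Set.Ioo a b ⊆ ⋃ v ∈ V, O v := by
    rintro _ ⟨s, hs, rfl⟩
    by_contra hcon
    have hsK : φ i s ∈ K := ⟨subset_closure (h.phi_mem i s (hab hs)), hcon⟩
    have hsT : s ∈ τ i '' K := ⟨_, hsK, h.tau_phi i s (hab hs)⟩
    have h1 : ∀ r, |r - s| < δ → r ∈ Set.Ioo (0:ℝ) 1 := fun r hr =>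
      hth (Metric.mem_thickening_iff.2 ⟨s, hsT, by rwa [Real.dist_eq]⟩)
    rcases hend with he | he
    · have := (h1 (s - δ/2) (by rw [abs_lt]; constructor <;> linarith)).1
      linarith [hs.2]
    · have := (h1 (s + δ/2) (by rw [abs_lt]; constructor <;> linarith)).2
      linarith [hs.1]
  obtain ⟨v, hv, htv⟩ := Set.mem_iUnion₂.1 (hPs ⟨t, ht, rfl⟩)
  have hsub : φ i '' Set.Ioo a b ⊆ O v := by
    refine hP.subset_left_of_subset_union (v := ⋃ v' ∈ V \ {v}, O v') (hO v)
      (isOpen_biUnion fun v' _ => hO v') ?_ ?_ ⟨_, ⟨t, ht, rfl⟩, htv⟩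
    · rw [Set.disjoint_left]
      intro x hx hx'
      obtain ⟨v', hv', hxv'⟩ := Set.mem_iUnion₂.1 hx'
      exact Set.disjoint_left.1 (hUd hv hv'.1 (fun e => hv'.2 e.symm)) hx.1 hxv'.1
    · intro x hx
      obtain ⟨v', hv', hxv'⟩ := Set.mem_iUnion₂.1 (hPs hx)
      by_cases e : v' = v
      · left; exact e ▸ hxv'
      · right; exact Set.mem_biUnion ⟨hv', e⟩ hxv'
  have h1 := (hsub ⟨t, ht, rfl⟩).2
  have h2 := (hsub ⟨t', ht', rfl⟩).2
  rw [Metric.mem_ball] at h1 h2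
  linarith [dist_triangle_right (φ i t) (φ i t') v]

theorem local_cut (h : MG V c φ τ f) (i : Fin k) {ε : ℝ} (hε : 0 < ε) (t : ℝ)
    (ht : t ∈ Set.Icc (0:ℝ) 1) : ∃ η > 0,
    (∀ s s', s ∈ Set.Ioo (0:ℝ) 1 → s' ∈ Set.Ioo (0:ℝ) 1 → s ∈ Set.Ico (t - η) t →
      s' ∈ Set.Ico (t - η) t → dist (φ i s) (φ i s') < ε) ∧
    (∀ s s', s ∈ Set.Ioo (0:ℝ) 1 → s' ∈ Set.Ioo (0:ℝ) 1 → s ∈ Set.Ico t (t + η) →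
      s' ∈ Set.Ico t (t + η) → dist (φ i s) (φ i s') < ε) := by
  obtain ⟨δ, hδ, hend⟩ := h.near_end i hε
  have hm : 0 < min δ 1 := lt_min hδ one_pos
  rcases eq_or_lt_of_le ht.1 with h0 | h0
  · subst h0
    refine ⟨min δ 1, hm, ?_, ?_⟩
    · intro s s' hs _ hs2 _
      linarith [hs.1, hs2.2]
    · intro s s' hs hs' hs2 hs2'
      refine hend 0 (min δ 1) (Set.Ioo_subset_Ioo_right (min_le_right _ _))
        (Or.inl (min_le_left _ _)) s ⟨hs.1, ?_⟩ s' ⟨hs'.1, ?_⟩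
      · linarith [hs2.2]
      · linarith [hs2'.2]
  rcases eq_or_lt_of_le ht.2 with h1 | h1
  · subst h1
    refine ⟨min δ 1 / 2, by linarith, ?_, ?_⟩
    · intro s s' hs hs' hs2 hs2'
      refine hend (1 - min δ 1) 1 (Set.Ioo_subset_Ioo_left ?_)
        (Or.inr ?_) s ⟨?_, hs.2⟩ s' ⟨?_, hs'.2⟩
      · linarith [min_le_right δ 1]
      · linarith [min_le_left δ 1]
      · linarith [hs2.1]
      · linarith [hs2'.1]
    · intro s s' hs _ hs2 _
      linarith [hs.2, hs2.1]
  have hc := (h.phi_cont i).continuousAt (Ioo_mem_nhds h0 h1)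
  obtain ⟨η, hη, hd⟩ := Metric.continuousAt_iff.1 hc (ε/2) (by linarith)
  refine ⟨η/2, by linarith, ?_, ?_⟩ <;>
  · intro s s' _ _ hs hs'
    have h2 := @hd s (by rw [Real.dist_eq, abs_lt]; constructor <;> linarith [hs.1, hs.2])
    have h3 := @hd s' (by rw [Real.dist_eq, abs_lt]; constructor <;> linarith [hs'.1, hs'.2])
    linarith [dist_triangle_right (φ i s) (φ i s') (φ i t)]

theorem cut (h : MG V c φ τ f) (i : Fin k) {ε : ℝ} (hε : 0 < ε) : ∃ S : Finset ℝ,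
    ∀ x ∈ c i, ∀ y ∈ c i, (∀ s ∈ S, τ i x < s ↔ τ i y < s) → dist x y < ε := by
  choose! η hη hl hr using h.local_cut i hε
  obtain ⟨T, hT, hcov⟩ := (isCompact_Icc (a := (0:ℝ)) (b := 1)).elim_nhds_subcover
    (fun t => Set.Ioo (t - η t) (t + η t))
    (fun t ht => Ioo_mem_nhds (by linarith [hη t ht]) (by linarith [hη t ht]))
  refine ⟨T.biUnion fun t => {t - η t, t, t + η t}, ?_⟩
  intro x hx y hy hs
  have hx1 := h.tau_mem i x hx
  have hy1 := h.tau_mem i y hy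
  obtain ⟨t, ht, hxt⟩ := Set.mem_iUnion₂.1 (hcov (Set.Ioo_subset_Icc_self hx1))
  have e1 := hs (t - η t) (Finset.mem_biUnion.2 ⟨t, ht, by simp⟩)
  have e2 := hs t (Finset.mem_biUnion.2 ⟨t, ht, by simp⟩)
  have e3 := hs (t + η t) (Finset.mem_biUnion.2 ⟨t, ht, by simp⟩)
  have hy2 : t - η t ≤ τ i y := by
    by_contra hcon
    push Not at hcon
    linarith [e1.2 hcon, hxt.1]
  have hy3 := e3.1 hxt.2
  rw [← h.phi_tau i x hx, ← h.phi_tau i y hy]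
  by_cases hlt : τ i x < t
  · exact hl t (hT t ht) _ _ hx1 hy1 ⟨hxt.1.le, hlt⟩ ⟨hy2, e2.1 hlt⟩
  · exact hr t (hT t ht) _ _ hx1 hy1 ⟨not_lt.1 hlt, hxt.2⟩
      ⟨not_lt.1 fun hcon => hlt (e2.2 hcon), hy3⟩

end MG

theorem rank_lemma {X ι : Type*} (I : Set X) (t : X → ℝ) (A : ι → X → Prop) (J : Finset ι)
    (hA : ∀ j ∈ J, (∀ x ∈ I, ∀ y ∈ I, t x ≤ t y → A j y → A j x) ∨
      (∀ x ∈ I, ∀ y ∈ I, t x ≤ t y → A j x → A j y)) :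
    ∃ r : X → ℕ, (∀ x, r x ≤ J.card) ∧
      ∀ x ∈ I, ∀ y ∈ I, r x = r y → ∀ j ∈ J, A j x ↔ A j y := by
  let L : ι → X → Prop := fun j x =>
    if (∀ x ∈ I, ∀ y ∈ I, t x ≤ t y → A j y → A j x) then A j x else ¬ A j x
  have hL : ∀ j ∈ J, ∀ x ∈ I, ∀ y ∈ I, t x ≤ t y → L j y → L j x := by
    intro j hj x hx y hy hxy hl
    simp only [L] at hl ⊢
    split_ifs at hl ⊢ with hc
    · exact hc x hx y hy hxy hl
    · have h2 := (hA j hj).resolve_left hc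
      exact fun hcon => hl (h2 x hx y hy hxy hcon)
  have hLA : ∀ j x y, (L j x ↔ L j y) → (A j x ↔ A j y) := by
    intro j x y
    simp only [L]
    split_ifs
    · exact id
    · exact fun h => not_iff_not.1 h
  refine ⟨fun x => (J.filter (L · x)).card, fun x => Finset.card_filter_le _ _, ?_⟩
  have key : ∀ x ∈ I, ∀ y ∈ I, t x ≤ t y → (J.filter (L · x)).card = (J.filter (L · y)).card →
      ∀ j ∈ J, (L j x ↔ L j y) := by
    intro x hx y hy hxy hr j hj
    have hsub : J.filter (L · y) ⊆ J.filter (L · x) := by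
      intro a ha
      rw [Finset.mem_filter] at ha ⊢
      exact ⟨ha.1, hL a ha.1 x hx y hy hxy ha.2⟩
    have := Finset.eq_of_subset_of_card_le hsub hr.le
    have h2 := Finset.ext_iff.1 this j
    simp only [Finset.mem_filter, hj, true_and] at h2
    exact h2.symm
  intro x hx y hy hr j hj
  apply hLA
  rcases le_total (t x) (t y) with hxy | hxy
  · exact key x hx y hy hxy hr j hj
  · exact (key y hy x hx hxy hr.symm j hj).symm

namespace MG

variable {G : Type*} [MetricSpace G] {V : Set G} {k : ℕ} {c : Fin k → Set G}
  {φ : Fin k → ℝ → G} {τ : Fin k → G → ℝ} {f : G → G} [CompactSpace G]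

theorem mono_cyl (h : MG V c φ τ f) (i : Fin k) (u : List (Fin k)) (m : ℕ)
    (hm : m < (i :: u).length) (s : ℝ) :
    (∀ x ∈ cyl c f (i::u), ∀ y ∈ cyl c f (i::u), τ i x ≤ τ i y →
      τ ((i::u)[m]) (f^[m] y) < s → τ ((i::u)[m]) (f^[m] x) < s) ∨
    (∀ x ∈ cyl c f (i::u), ∀ y ∈ cyl c f (i::u), τ i x ≤ τ i y →
      τ ((i::u)[m]) (f^[m] x) < s → τ ((i::u)[m]) (f^[m] y) < s) := by
  by_cases hne : (cyl c f (i::u)).Nonempty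
  swap
  · left
    intro x hx
    exact (hne ⟨x, hx⟩).elim
  have hci : ∀ x ∈ cyl c f (i::u), x ∈ c i := fun x hx => hx.1
  have hmaps : ∀ t ∈ τ i '' cyl c f (i::u), t ∈ Set.Ioo (0:ℝ) 1 ∧ φ i t ∈ cyl c f (i::u) := by
    rintro _ ⟨x, hx, rfl⟩
    exact ⟨h.tau_mem i x (hci x hx), by rw [h.phi_tau i x (hci x hx)]; exact hx⟩
  have hcont : ContinuousOn (fun t => τ ((i::u)[m]) (f^[m] (φ i t))) (τ i '' cyl c f (i::u)) := by
    refine (h.tau_cont ((i::u)[m])).comp (t := c ((i::u)[m])) ?_ ?_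
    · exact (h.cont.iterate m).comp_continuousOn
        ((h.phi_cont i).mono fun t ht => (hmaps t ht).1)
    · intro t ht
      exact mem_cyl_get _ _ (hmaps t ht).2 m hm
  have hinj : Set.InjOn (fun t => τ ((i::u)[m]) (f^[m] (φ i t))) (τ i '' cyl c f (i::u)) := by
    intro t ht t' ht' he
    have h1 := h.tau_inj _ (mem_cyl_get _ _ (hmaps t ht).2 m hm)
      (mem_cyl_get _ _ (hmaps t' ht').2 m hm) he
    have h2 := h.cyl_inj (i::u) m hm.le (hmaps t ht).2 (hmaps t' ht').2 h1
    rw [← h.tau_phi i t (hmaps t ht).1, h2, h.tau_phi i t' (hmaps t' ht').1]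
  rcases strictMono_or_anti_of_ordConnected (h.tau_cyl i u hne) hcont hinj with hmo | hmo
  · left
    intro x hx y hy hxy hs
    have := hmo.monotoneOn ⟨x, hx, rfl⟩ ⟨y, hy, rfl⟩ hxy
    simp only [h.phi_tau i x (hci x hx), h.phi_tau i y (hci y hy)] at this
    linarith
  · right
    intro x hx y hy hxy hs
    have := hmo.antitoneOn ⟨x, hx, rfl⟩ ⟨y, hy, rfl⟩ hxy
    simp only [h.phi_tau i x (hci x hx), h.phi_tau i y (hci y hy)] at this
    linarith

theorem rank_cyl (h : MG V c φ τ f) {ε : ℝ} (hε : 0 < ε) : ∃ Q : ℕ, ∀ w : List (Fin k),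
    ∃ r : G → ℕ, (∀ x, r x ≤ w.length * Q) ∧ ∀ x ∈ cyl c f w, ∀ y ∈ cyl c f w, r x = r y →
      ∀ m < w.length, dist (f^[m] x) (f^[m] y) < ε := by
  choose S hS using fun i => h.cut i hε
  refine ⟨(Finset.univ.biUnion S).card, ?_⟩
  intro w
  rcases w with _ | ⟨i, u⟩
  · exact ⟨fun _ => 0, by simp, by simp⟩
  obtain ⟨r, hr1, hr2⟩ := rank_lemma (cyl c f (i::u)) (τ i)
    (fun (j : Fin (i::u).length × ℝ) x => τ ((i::u)[j.1]) (f^[j.1] x) < j.2)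
    (Finset.univ ×ˢ Finset.univ.biUnion S) (fun j _ => h.mono_cyl i u j.1 j.1.2 j.2)
  refine ⟨r, ?_, ?_⟩
  · intro x
    have := hr1 x
    rwa [Finset.card_product, Finset.card_univ, Fintype.card_fin] at this
  · intro x hx y hy hxy m hm
    refine hS ((i::u)[m]) _ (mem_cyl_get _ _ hx m hm) _ (mem_cyl_get _ _ hy m hm) ?_
    intro s hs
    exact hr2 x hx y hy hxy (⟨m, hm⟩, s) (Finset.mem_product.2 ⟨Finset.mem_univ _,
      Finset.mem_biUnion.2 ⟨_, Finset.mem_univ _, hs⟩⟩)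

theorem upper (h : MG V c φ τ f) [Nonempty G] {ε : ℝ} (hε : 0 < ε) : ∃ Q : ℕ, ∀ n : ℕ,
    ∃ s : Finset G, IsDynCoverOf f Set.univ {p : G × G | dist p.1 p.2 < ε} n s ∧
      s.card ≤ (awds c f n).card * (n * Q + 1) +
        ∑ m ∈ Finset.range n, (awds c f m).card * h.fin.toFinset.card := by
  obtain ⟨Q, hQ⟩ := h.rank_cyl hε
  choose r hr1 hr2 using hQ
  refine ⟨Q, fun n => ?_⟩
  let g : List (Fin k) × ℕ → G := fun p =>
    if hp : ∃ x ∈ cyl c f p.1, r p.1 x = p.2 then hp.choose else Classical.arbitrary G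
  let g' : ℕ → List (Fin k) × G → G := fun m p =>
    if hp : ∃ x ∈ cyl c f p.1, f^[m] x = p.2 then hp.choose else Classical.arbitrary G
  refine ⟨(awds c f n ×ˢ Finset.range (n * Q + 1)).image g ∪
    (Finset.range n).biUnion fun m => (awds c f m ×ˢ h.fin.toFinset).image (g' m), ?_, ?_⟩
  · intro x _
    simp only [mem_dynEntourage, Set.mem_ofPred_eq]
    by_cases hx : ∀ m < n, f^[m] x ∉ V
    · obtain ⟨w, hw, hxw⟩ := h.exists_word n x hx
      have hp : ∃ y ∈ cyl c f w, r w y = r w x := ⟨x, hxw, rfl⟩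
      refine ⟨g (w, r w x), ?_, ?_⟩
      · simp only [Finset.coe_union, Set.mem_union]
        left
        refine Finset.mem_coe.2 (Finset.mem_image_of_mem _ (Finset.mem_product.2 ⟨?_, ?_⟩))
        · exact mem_awds.2 ⟨hw, x, hxw⟩
        · have := hr1 w x
          rw [hw] at this
          exact Finset.mem_range.2 (by simpa using Nat.lt_succ_of_le this)
      · intro m hm
        have hg : g (w, r w x) = hp.choose := dif_pos hp
        rw [hg]
        exact hr2 w x hxw _ hp.choose_spec.1 hp.choose_spec.2.symm m (by omega)
    · push Not at hx
      have hmn := Nat.find_spec hx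
      have hmin : ∀ m < Nat.find hx, f^[m] x ∉ V := by
        intro m hm hcon
        exact Nat.find_min hx hm ⟨by omega, hcon⟩
      obtain ⟨w, hw, hxw⟩ := h.exists_word _ x hmin
      set m := Nat.find hx
      have hp : ∃ y ∈ cyl c f w, f^[m] y = f^[m] x := ⟨x, hxw, rfl⟩
      have hg : g' m (w, f^[m] x) = hp.choose := dif_pos hp
      have hg2 : g' m (w, f^[m] x) = x := by
        rw [hg]
        exact h.cyl_inj w m hw.ge hp.choose_spec.1 hxw hp.choose_spec.2
      refine ⟨x, ?_, fun _ _ => by rw [dist_self]; exact hε⟩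
      simp only [Finset.coe_union, Set.mem_union]
      right
      refine Finset.mem_coe.2 (Finset.mem_biUnion.2 ⟨m, Finset.mem_range.2 hmn.1, ?_⟩)
      refine Finset.mem_image.2 ⟨_, Finset.mem_product.2 ⟨mem_awds.2 ⟨hw, x, hxw⟩, ?_⟩, hg2⟩
      exact h.fin.mem_toFinset.2 hmn.2
  · refine (Finset.card_union_le _ _).trans (add_le_add ?_ ?_)
    · refine Finset.card_image_le.trans ?_
      rw [Finset.card_product, Finset.card_range]
    · refine Finset.card_biUnion_le.trans (Finset.sum_le_sum fun m _ => ?_)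
      refine Finset.card_image_le.trans ?_
      rw [Finset.card_product]

end MG

theorem numeric_upper (a : ℕ → ℕ) (r q C : ℝ) (hr : 1 ≤ r) (hq : r < q)
    (ha : ∀ᶠ n in Filter.atTop, (a n : ℝ) ≤ C * r ^ n) (Q v : ℕ) :
    ∀ᶠ n in Filter.atTop,
      ((a n * (n * Q + 1) + ∑ m ∈ Finset.range n, a m * v : ℕ) : ℝ) ≤ q ^ n := by
  obtain ⟨C', hC', hall⟩ : ∃ C' : ℝ, 0 ≤ C' ∧ ∀ n, (a n : ℝ) ≤ C' * r ^ n := by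
    obtain ⟨N, hN⟩ := Filter.eventually_atTop.1 ha
    have hs : 0 ≤ ∑ m ∈ Finset.range N, (a m : ℝ) := Finset.sum_nonneg fun _ _ => Nat.cast_nonneg _
    refine ⟨|C| + ∑ m ∈ Finset.range N, (a m : ℝ), by positivity, fun n => ?_⟩
    have hrn : 1 ≤ r ^ n := one_le_pow₀ hr
    rcases lt_or_ge n N with h | h
    · have h1 : (a n : ℝ) ≤ ∑ m ∈ Finset.range N, (a m : ℝ) :=
        Finset.single_le_sum (f := fun m => (a m : ℝ)) (fun _ _ => Nat.cast_nonneg _)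
          (Finset.mem_range.2 h)
      nlinarith [abs_nonneg C]
    · have := hN n h
      nlinarith [le_abs_self C]
  have hq0 : 0 < q := by linarith
  have hr0 : 0 ≤ r / q := by positivity
  have hr1 : r / q < 1 := (div_lt_one hq0).2 hq
  have t1 := (tendsto_self_mul_const_pow_of_lt_one hr0 hr1).const_mul (C' * (Q + v))
  have t2 := (tendsto_pow_atTop_nhds_zero_of_lt_one hr0 hr1).const_mul C'
  have t := t1.add t2
  simp only [mul_zero, add_zero] at t
  filter_upwards [t.eventually (ge_mem_nhds one_pos)] with n hn
  have hqn : 0 < q ^ n := by positivity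
  have hsum : ∑ m ∈ Finset.range n, (a m : ℝ) * v ≤ n * (C' * r ^ n * v) := by
    calc _ ≤ ∑ m ∈ Finset.range n, (C' * r ^ n * v) := by
          refine Finset.sum_le_sum fun m hm => ?_
          have h1 := hall m
          have h2 : r ^ m ≤ r ^ n := pow_le_pow_right₀ hr (Finset.mem_range.1 hm).le
          have : (a m : ℝ) ≤ C' * r ^ n := h1.trans (by gcongr)
          gcongr
      _ = _ := by simp
  have hmain : (a n : ℝ) * (n * Q + 1) ≤ C' * r ^ n * (n * Q + 1) := by
    have := hall n
    gcongr
  push_cast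
  rw [div_pow] at hn
  have h3 : C' * r ^ n * (n * Q + 1) + n * (C' * r ^ n * v) ≤ q ^ n := by
    have := mul_le_mul_of_nonneg_right hn hqn.le
    calc _ = (C' * (Q + v) * (n * (r ^ n / q ^ n)) + C' * (r ^ n / q ^ n)) * q ^ n := by
          field_simp
          ring
      _ ≤ _ := by linarith
  linarith

theorem numeric_lower (R β K : ℝ) (hβ : 0 < β) (hR : β < R) (hK : 1 ≤ K)
    (H : ∀ m : ℕ, 1 ≤ m → ∃ C : ℝ, ∀ᶠ n in Filter.atTop, R ^ (n * m) ≤ C * β ^ (n * m) * K ^ n) :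
    False := by
  obtain ⟨m, hm⟩ := pow_unbounded_of_one_lt K ((one_lt_div hβ).2 hR)
  have hm1 : 1 ≤ m := by
    rcases Nat.eq_zero_or_pos m with h | h
    · subst h; simp at hm; linarith
    · exact h
  obtain ⟨C, hC⟩ := H m hm1
  have hK0 : 0 < K := by linarith
  have ht := tendsto_pow_atTop_atTop_of_one_lt ((one_lt_div hK0).2 hm)
  obtain ⟨n, h1, h2⟩ := (hC.and (ht.eventually_gt_atTop C)).exists
  have : ((R / β) ^ m / K) ^ n ≤ C := by
    rw [div_pow, div_pow, div_pow, ← pow_mul, ← pow_mul, div_div, div_le_iff₀ (by positivity),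
      mul_comm m n]
    linarith
  linarith

namespace MG

variable {G : Type*} [MetricSpace G] {V : Set G} {k : ℕ} {c : Fin k → Set G}
  {φ : Fin k → ℝ → G} {τ : Fin k → G → ℝ} {f : G → G} [CompactSpace G]

theorem ent_le (h : MG V c φ τ f) [Nonempty G] (t : ENNReal) (ht : 1 ≤ t)
    (H : ∀ r : ℝ, 1 ≤ r → t < ENNReal.ofReal r → ∃ C : ℝ, ∀ᶠ n in Filter.atTop,
      ((awds c f n).card : ℝ) ≤ C * r ^ n) :
    coverEntropy f (Set.univ : Set G) ≤ ENNReal.log t := by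
  refine le_of_forall_gt_imp_ge_of_dense fun y hy => ?_
  have hy' : t < EReal.exp y := by
    rw [← ENNReal.log_lt_log_iff, EReal.log_exp]; exact hy
  obtain ⟨b, hb1, hb2⟩ := exists_between hy'
  obtain ⟨d, hd1, hd2⟩ := exists_between hb1
  have hbt : b ≠ ⊤ := hb2.ne_top
  have hdt : d ≠ ⊤ := hd2.ne_top
  have hbr : ENNReal.ofReal b.toReal = b := ENNReal.ofReal_toReal hbt
  have hdr : ENNReal.ofReal d.toReal = d := ENNReal.ofReal_toReal hdt
  have h1d : 1 ≤ d.toReal := by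
    have := (ENNReal.toReal_le_toReal ENNReal.one_ne_top hdt).2 (ht.trans hd1.le)
    simpa using this
  have hdb : d.toReal < b.toReal := (ENNReal.toReal_lt_toReal hdt hbt).2 hd2
  obtain ⟨C, hC⟩ := H d.toReal h1d (by rw [hdr]; exact hd1)
  have hlog : ENNReal.log b ≤ y := by
    rw [← EReal.log_exp y]; exact ENNReal.log_le_log hb2.le
  refine le_trans ?_ hlog
  refine iSup₂_le fun U hU => ?_
  obtain ⟨ε, hε, hεU⟩ := Metric.mem_uniformity_dist.1 hU
  obtain ⟨Q, hQ⟩ := h.upper hε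
  rw [← ExpGrowth.expGrowthSup_pow (b := b)]
  refine ExpGrowth.expGrowthSup_eventually_monotone ?_
  filter_upwards [numeric_upper (fun n => (awds c f n).card) _ _ C h1d hdb hC Q
    h.fin.toFinset.card] with n hn
  obtain ⟨s, hs, hcard⟩ := hQ n
  have hs' : IsDynCoverOf f Set.univ U n (s : Set G) :=
    hs.of_entourage_subset fun p hp => hεU hp
  have h1 := hs'.coverMincard_le_card
  calc ((coverMincard f Set.univ U n : ℕ∞) : ENNReal) ≤ ((s.card : ℕ∞) : ENNReal) := by
        exact_mod_cast h1
    _ = ENNReal.ofReal (s.card : ℝ) := by simp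
    _ ≤ ENNReal.ofReal (b.toReal ^ n) := by
        apply ENNReal.ofReal_le_ofReal
        exact le_trans (by exact_mod_cast hcard) hn
    _ = b ^ n := by rw [ENNReal.ofReal_pow ENNReal.toReal_nonneg, hbr]

theorem le_ent (h : MG V c φ τ f) [Nonempty G] (ρ : ENNReal)
    (H : ∀ n, ρ ^ n ≤ ((awds c f (n+1)).card : ENNReal)) :
    ENNReal.log ρ ≤ coverEntropy f (Set.univ : Set G) := by
  by_contra hcon
  push Not at hcon
  obtain ⟨y, hy1, hy2⟩ := exists_between hcon
  have hy0 : 0 ≤ y := (coverEntropy_nonneg f Set.univ_nonempty).trans hy1.le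
  set b := EReal.exp y with hb
  have hyb : y = ENNReal.log b := (EReal.log_exp y).symm
  have hbρ : b < ρ := by rw [hyb] at hy2; exact ENNReal.log_lt_log_iff.1 hy2
  have hb1 : 1 ≤ b := by rw [hyb] at hy0; exact ENNReal.zero_le_log_iff.1 hy0
  have hρt : ρ ≠ ⊤ := by
    have := H 1
    rw [pow_one] at this
    exact ne_top_of_le_ne_top (ENNReal.natCast_ne_top _) this
  have hbt : b ≠ ⊤ := hbρ.ne_top
  have hbr : ENNReal.ofReal b.toReal = b := ENNReal.ofReal_toReal hbt
  have h1b : 1 ≤ b.toReal := by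
    have := (ENNReal.toReal_le_toReal ENNReal.one_ne_top hbt).2 hb1
    simpa using this
  refine numeric_lower ρ.toReal b.toReal (6 * k + 1) (by linarith)
    ((ENNReal.toReal_lt_toReal hbt hρt).2 hbρ) (by linarith [(Nat.cast_nonneg k : (0:ℝ) ≤ k)]) ?_
  intro m hm
  obtain ⟨U, hU, hUs⟩ := h.lower m
  refine ⟨b.toReal * k, ?_⟩
  have he := ExpGrowth.eventually_le_exp
    ((coverEntropyEntourage_le_coverEntropy f Set.univ hU).trans_lt hy1)
  have htend : Filter.Tendsto (fun n : ℕ => n * m + 1) Filter.atTop Filter.atTop := by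
    refine Filter.tendsto_atTop_mono (fun n => ?_) Filter.tendsto_id
    simp only [id]
    nlinarith
  filter_upwards [htend.eventually he] with n hn
  obtain ⟨s, hs, hcard⟩ := (coverMincard_finite_iff f Set.univ U (n*m+1)).1
    (coverMincard_finite_of_isCompact_invariant isCompact_univ (Set.mapsTo_univ _ _) hU _)
  have hle := hUs n s hs
  rw [← hcard] at hn
  have hexp : EReal.exp (y * ((n * m + 1 : ℕ) : EReal)) = b ^ (n * m + 1) := by
    have := EReal.exp_mul y ((n * m + 1 : ℕ) : ℝ)
    rw [ENNReal.rpow_natCast] at this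
    rw [← this]
    rfl
  rw [hexp] at hn
  have hsb : (s.card : ℝ) ≤ b.toReal ^ (n * m + 1) := by
    have := ENNReal.toReal_mono (ENNReal.pow_ne_top hbt) hn
    simpa using this
  have hρ : ρ.toReal ^ (n * m) ≤ ((awds c f (n * m + 1)).card : ℝ) := by
    have := ENNReal.toReal_mono (ENNReal.natCast_ne_top _) (H (n * m))
    simpa using this
  have hle' : ((awds c f (n * m + 1)).card : ℝ) ≤ s.card * (k * (6 * k) ^ n) := by
    exact_mod_cast hle
  calc ρ.toReal ^ (n * m) ≤ s.card * (k * (6 * k) ^ n) := hρ.trans hle'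
    _ ≤ b.toReal ^ (n * m + 1) * (k * (6 * k + 1) ^ n) := by
        gcongr
        linarith
    _ = _ := by ring

end MG

section
attribute [local instance] Matrix.linftyOpNormedRing Matrix.linftyOpNormedAlgebra

namespace MG

variable {G : Type*} [MetricSpace G] {V : Set G} {k : ℕ} {c : Fin k → Set G}
  {φ : Fin k → ℝ → G} {τ : Fin k → G → ℝ} {f : G → G} [CompactSpace G]

theorem row_sum (h : MG V c φ τ f) (B : Matrix (Fin k) (Fin k) ℕ)
    (hB : ∀ i j, B i j = if ∃ x ∈ c i, f x ∈ c j then 1 else 0) (n : ℕ) (i : Fin k) :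
    ∑ j, (B ^ n) i j = (wds c f n i).card := by
  induction n generalizing i with
  | zero => simp [h.card_wds_zero, Matrix.one_apply]
  | succ n ih =>
    rw [h.card_wds_succ, pow_succ']
    simp only [Matrix.mul_apply]
    rw [Finset.sum_comm]
    refine Finset.sum_congr rfl fun j _ => ?_
    rw [← Finset.mul_sum, ih, hB]

theorem norm_pow (h : MG V c φ τ f) (D : Matrix (Fin k) (Fin k) ℂ)
    (hD : ∀ i j, D i j = if ∃ x ∈ c i, f x ∈ c j then 1 else 0) (n : ℕ) :
    ‖D ^ n‖₊ = Finset.univ.sup fun i => ((wds c f n i).card : NNReal) := by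
  let B : Matrix (Fin k) (Fin k) ℕ := fun i j => if ∃ x ∈ c i, f x ∈ c j then 1 else 0
  have hDB : D = B.map (Nat.castRingHom ℂ) := by
    ext i j
    rw [hD, Matrix.map_apply]
    simp only [B]
    split_ifs <;> simp
  have hpow : D ^ n = (B ^ n).map (Nat.castRingHom ℂ) := by
    rw [hDB]
    exact (map_pow (Nat.castRingHom ℂ).mapMatrix B n).symm
  rw [Matrix.linfty_opNNNorm_def, hpow]
  refine Finset.sup_congr rfl fun i _ => ?_
  rw [← h.row_sum B (fun _ _ => rfl) n i]
  push_cast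
  refine Finset.sum_congr rfl fun j _ => ?_
  rw [Matrix.map_apply]
  simp

theorem norm_le (h : MG V c φ τ f) (D : Matrix (Fin k) (Fin k) ℂ)
    (hD : ∀ i j, D i j = if ∃ x ∈ c i, f x ∈ c j then 1 else 0) (n : ℕ) :
    ‖D ^ n‖₊ ≤ ((awds c f (n+1)).card : NNReal) := by
  rw [h.norm_pow D hD]
  refine Finset.sup_le fun i _ => ?_
  rw [card_awds_succ]
  exact_mod_cast Finset.single_le_sum (f := fun i => (wds c f n i).card)
    (fun _ _ => Nat.zero_le _) (Finset.mem_univ i)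

theorem le_norm (h : MG V c φ τ f) (D : Matrix (Fin k) (Fin k) ℂ)
    (hD : ∀ i j, D i j = if ∃ x ∈ c i, f x ∈ c j then 1 else 0) (n : ℕ) :
    ((awds c f (n+1)).card : NNReal) ≤ k * ‖D ^ n‖₊ := by
  rw [h.norm_pow D hD, card_awds_succ]
  push_cast
  calc _ ≤ ∑ _i : Fin k, Finset.univ.sup fun i => ((wds c f n i).card : NNReal) :=
        Finset.sum_le_sum fun i _ =>
          Finset.le_sup (f := fun i => ((wds c f n i).card : NNReal)) (Finset.mem_univ i)
    _ = _ := by simp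

theorem norm_ge_one (h : MG V c φ τ f) (D : Matrix (Fin k) (Fin k) ℂ)
    (hD : ∀ i j, D i j = if ∃ x ∈ c i, f x ∈ c j then 1 else 0) (n : ℕ) (hn : D ^ n ≠ 0) :
    1 ≤ ‖D ^ n‖₊ := by
  by_contra hcon
  push Not at hcon
  apply hn
  rw [← nnnorm_eq_zero]
  rw [h.norm_pow D hD] at hcon ⊢
  rw [← bot_eq_zero, Finset.sup_eq_bot_iff]
  intro i _
  have := (Finset.le_sup (f := fun i => ((wds c f n i).card : NNReal)) (Finset.mem_univ i)).trans_lt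
    hcon
  have h2 : (wds c f n i).card < 1 := by exact_mod_cast this
  have h3 : (wds c f n i).card = 0 := by omega
  rw [h3]; simp

theorem ent_le' (h : MG V c φ τ f) [Nonempty G] (D : Matrix (Fin k) (Fin k) ℂ)
    (hD : ∀ i j, D i j = if ∃ x ∈ c i, f x ∈ c j then 1 else 0) (t : ENNReal) (ht : 1 ≤ t)
    (H : ∀ r : ℝ, 1 ≤ r → t < ENNReal.ofReal r → ∀ᶠ n in Filter.atTop, ‖D ^ n‖ ≤ r ^ n) :
    coverEntropy f (Set.univ : Set G) ≤ ENNReal.log t := by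
  refine h.ent_le t ht fun r hr htr => ⟨k, ?_⟩
  have h1 : ∀ᶠ n in Filter.atTop, ((awds c f (n+1)).card : ℝ) ≤ k * r ^ (n+1) := by
    filter_upwards [H r hr htr] with n hn
    have h2 : ((awds c f (n+1)).card : ℝ) ≤ k * ‖D ^ n‖ := by exact_mod_cast h.le_norm D hD n
    have h3 : r ^ n ≤ r ^ (n+1) := pow_le_pow_right₀ hr (Nat.le_succ n)
    exact h2.trans (by gcongr; linarith)
  obtain ⟨N, hN⟩ := Filter.eventually_atTop.1 h1
  refine Filter.eventually_atTop.2 ⟨N+1, fun n hn => ?_⟩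
  obtain ⟨m, rfl⟩ : ∃ m, n = m + 1 := ⟨n - 1, by omega⟩
  exact hN m (by omega)

theorem nil_case (h : MG V c φ τ f) [Nonempty G] (D : Matrix (Fin k) (Fin k) ℂ)
    (hD : ∀ i j, D i j = if ∃ x ∈ c i, f x ∈ c j then 1 else 0) (hnil : IsNilpotent D) :
    coverEntropy f (Set.univ : Set G) = 0 := by
  refine le_antisymm ?_ (coverEntropy_nonneg f Set.univ_nonempty)
  rw [← ENNReal.log_one]
  refine h.ent_le' D hD 1 le_rfl fun r hr _ => ?_
  obtain ⟨N, hN⟩ := hnil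
  filter_upwards [Filter.eventually_ge_atTop N] with n hn
  rw [pow_eq_zero_of_le hn hN, norm_zero]
  positivity

theorem non_nil_case (h : MG V c φ τ f) [Nonempty G] (D : Matrix (Fin k) (Fin k) ℂ)
    (hD : ∀ i j, D i j = if ∃ x ∈ c i, f x ∈ c j then 1 else 0) (hnil : ¬ IsNilpotent D) :
    coverEntropy f (Set.univ : Set G) = ((Real.log ((spectralRadius ℂ D).toReal) : ℝ) : EReal) := by
  have hne : Nonempty (Fin k) := by
    by_contra hcon
    rw [not_nonempty_iff] at hcon
    exact hnil ⟨1, Subsingleton.elim _ _⟩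
  have : CompleteSpace (Matrix (Fin k) (Fin k) ℂ) := FiniteDimensional.complete ℂ _
  have hge : ∀ n, 1 ≤ ‖D ^ n‖₊ := fun n => h.norm_ge_one D hD n fun hcon => hnil ⟨n, hcon⟩
  have hG := spectrum.pow_nnnorm_pow_one_div_tendsto_nhds_spectralRadius D
  have hρ1 : 1 ≤ spectralRadius ℂ D := by
    refine ge_of_tendsto' hG fun n => ?_
    calc (1 : ENNReal) = 1 ^ (1 / (n : ℝ)) := (ENNReal.one_rpow _).symm
      _ ≤ _ := ENNReal.rpow_le_rpow (by exact_mod_cast hge n) (by positivity)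
  have hρt : spectralRadius ℂ D ≠ ⊤ :=
    ne_top_of_le_ne_top ENNReal.coe_ne_top (spectrum.spectralRadius_le_nnnorm D)
  rw [← ENNReal.log_pos_real (by intro h0; rw [h0] at hρ1; simp at hρ1) hρt]
  refine le_antisymm ?_ ?_
  · refine h.ent_le' D hD _ hρ1 fun r hr htr => ?_
    filter_upwards [hG.eventually (gt_mem_nhds htr), Filter.eventually_gt_atTop 0] with n hn hn0
    have hn0' : (n : ℝ) ≠ 0 := Nat.cast_ne_zero.2 (Nat.pos_iff_ne_zero.1 hn0)
    have h1 := ENNReal.rpow_le_rpow hn.le (Nat.cast_nonneg n : (0:ℝ) ≤ n)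
    rw [← ENNReal.rpow_mul, one_div_mul_cancel hn0', ENNReal.rpow_one, ENNReal.rpow_natCast,
      ← ENNReal.ofReal_pow (by linarith)] at h1
    have h2 := ENNReal.toReal_mono ENNReal.ofReal_ne_top h1
    rw [ENNReal.toReal_ofReal (by positivity)] at h2
    simpa using h2
  · refine h.le_ent _ fun n => ?_
    refine ((spectrum.spectralRadius_pow_le' D n).trans
      (spectrum.spectralRadius_le_nnnorm (D ^ n))).trans ?_
    exact_mod_cast h.norm_le D hD n

end MG

end

/-- Proposition 2.5: for a continuous Markov map `f` of a finite topological graph `G`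
(with vertex set `V`, whose edges `e i = closure (c i)` are the closures of the finitely
many connected components `c i` of `G \ V`, each homeomorphic to the open interval `(0,1)`),
the topological entropy of `f` on `G` is `0` if the incidence matrix `D` is nilpotent, and
`log λ` otherwise, where `λ` is the spectral radius of `D`. -/
theorem coverEntropy_markov_graph_map
    {G : Type*} [MetricSpace G] [CompactSpace G]
    (V : Set G) (hVfin : V.Finite) (hVne : V.Nonempty)
    (k : ℕ) (c : Fin k → Set G)
    (hc_comp : ∀ i, ∃ x ∈ Vᶜ, c i = connectedComponentIn Vᶜ x)
    (hc_all : ∀ x ∈ Vᶜ, ∃ i, connectedComponentIn Vᶜ x = c i)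
    (hc_inj : Function.Injective c)
    (hc_homeo : ∀ i, Nonempty (↥(c i) ≃ₜ ↥(Set.Ioo (0 : ℝ) 1)))
    (e : Fin k → Set G) (he : ∀ i, e i = closure (c i))
    (f : G → G) (hf : Continuous f)
    (hfV : Set.MapsTo f V V)
    (hMarkov : ∀ i, Set.InjOn f (e i))
    (D : Matrix (Fin k) (Fin k) ℂ)
    (hD : ∀ i j, D i j = if e j ⊆ f '' (e i) then 1 else 0) :
    (IsNilpotent D → coverEntropy f (Set.univ : Set G) = 0) ∧
      (¬ IsNilpotent D →
        coverEntropy f (Set.univ : Set G)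
          = ((Real.log ((spectralRadius ℂ D).toReal) : ℝ) : EReal)) := by
  obtain rfl : e = fun i => closure (c i) := funext he
  obtain ⟨φ, τ, h⟩ := MG.exists_of V hVfin k c hc_comp hc_all hc_inj hc_homeo f hf hfV hMarkov
  have : Nonempty G := ⟨hVne.some⟩
  have hD' : ∀ i j, D i j = if ∃ x ∈ c i, f x ∈ c j then 1 else 0 := by
    intro i j
    rw [hD]
    simp only [h.edge_iff i j]
  exact ⟨h.nil_case D hD', h.non_nil_case D hD'⟩
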